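/- arXiv:2209.10805 — 3 statements merged into one kernel-verified Lean document; each statement's English description precedes it below -/
import Mathlib

section
/- Let M be a popular feasible matching in a marriage instance with critical men, and suppose there exists a popular feasible matching of strictly smaller cardinality than M. Then G contains an M-alternating path ρ both of whose terminal edges lie in M, whose endpoint in A is a non-critical man, and whose number of (+1,+1) edges is exactly one more than its number of (−1,−1) edges; consequently the symmetric difference M △ ρ is a feasible matching of cardinality |M| − 1. -/
open Classical

universe u v

/-- A marriage instance with critical men: a finite bipartite graph with edge set `E ⊆ A × B`,
a set `C ⊆ A` of critical men, and strict preference orders of each vertex over its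
neighbours (`prefA m w w'` : man `m` strictly prefers woman `w` to woman `w'`;
`prefB w m m'` : woman `w` strictly prefers man `m` to man `m'`). -/
structure CritInstance (A : Type u) (B : Type v) where
  E : Finset (A × B)
  C : Finset A
  prefA : A → B → B → Prop
  prefB : B → A → A → Prop
  prefA_irrefl : ∀ m w, ¬ prefA m w w
  prefA_trans : ∀ m w₁ w₂ w₃, prefA m w₁ w₂ → prefA m w₂ w₃ → prefA m w₁ w₃
  prefA_total : ∀ m w₁ w₂, (m, w₁) ∈ E → (m, w₂) ∈ E → w₁ ≠ w₂ →
    prefA m w₁ w₂ ∨ prefA m w₂ w₁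
  prefB_irrefl : ∀ w m, ¬ prefB w m m
  prefB_trans : ∀ w m₁ m₂ m₃, prefB w m₁ m₂ → prefB w m₂ m₃ → prefB w m₁ m₃
  prefB_total : ∀ w m₁ m₂, (m₁, w) ∈ E → (m₂, w) ∈ E → m₁ ≠ m₂ →
    prefB w m₁ m₂ ∨ prefB w m₂ m₁

namespace CritInstance

variable {A : Type u} {B : Type v}

/-- `M` is a matching: a set of edges in which every vertex has at most one partner. -/
def IsMatching (I : CritInstance A B) (M : Finset (A × B)) : Prop :=
  M ⊆ I.E ∧ (∀ ⦃m w w'⦄, (m, w) ∈ M → (m, w') ∈ M → w = w') ∧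
    (∀ ⦃m m' w⦄, (m, w) ∈ M → (m', w) ∈ M → m = m')

/-- Man `m` is matched in `M`. -/
def ManMatched (M : Finset (A × B)) (m : A) : Prop := ∃ w, (m, w) ∈ M

/-- Woman `w` is matched in `M`. -/
def WomanMatched (M : Finset (A × B)) (w : B) : Prop := ∃ m, (m, w) ∈ M

/-- `M` is feasible: it is a matching and every critical man is matched. -/
def IsFeasible (I : CritInstance A B) (M : Finset (A × B)) : Prop :=
  IsMatching I M ∧ ∀ m ∈ I.C, ManMatched M m

/-- Man `m` prefers matching `M` to matching `N`: he is matched in `M` and either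
unmatched in `N` or strictly prefers his `M`-partner to his `N`-partner. -/
def ManPrefers (I : CritInstance A B) (M N : Finset (A × B)) (m : A) : Prop :=
  ∃ w, (m, w) ∈ M ∧ (¬ ManMatched N m ∨ ∃ w', (m, w') ∈ N ∧ I.prefA m w w')

/-- Woman `w` prefers matching `M` to matching `N`. -/
def WomanPrefers (I : CritInstance A B) (M N : Finset (A × B)) (w : B) : Prop :=
  ∃ m, (m, w) ∈ M ∧ (¬ WomanMatched N w ∨ ∃ m', (m', w) ∈ N ∧ I.prefB w m m')

/-- `phi I M N` is the number of vertices that prefer `M` to `N`. -/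
noncomputable def phi [Fintype A] [Fintype B] (I : CritInstance A B)
    (M N : Finset (A × B)) : ℕ :=
  (Finset.univ.filter fun m : A => ManPrefers I M N m).card +
    (Finset.univ.filter fun w : B => WomanPrefers I M N w).card

/-- `M` is a popular feasible matching. -/
def IsPFM [Fintype A] [Fintype B] (I : CritInstance A B) (M : Finset (A × B)) : Prop :=
  IsFeasible I M ∧ ∀ N, IsFeasible I N → phi I N M ≤ phi I M N

/-- `M` is a minimum size popular feasible matching. -/
def IsMinPFM [Fintype A] [Fintype B] (I : CritInstance A B) (M : Finset (A × B)) : Prop :=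
  IsPFM I M ∧ ∀ N, IsPFM I N → M.card ≤ N.card

/-- `M` is a dominant feasible matching. -/
def IsDFM [Fintype A] [Fintype B] (I : CritInstance A B) (M : Finset (A × B)) : Prop :=
  IsPFM I M ∧ ∀ N, IsFeasible I N → M.card < N.card → phi I N M < phi I M N

/-- `(m,w)` is a `(+1,+1)` edge with respect to `M`: an edge of `E ∖ M` such that `m` is
unmatched or prefers `w` to his partner, and `w` is unmatched or prefers `m` to her partner. -/
def PlusPlus (I : CritInstance A B) (M : Finset (A × B)) (m : A) (w : B) : Prop :=
  (m, w) ∈ I.E ∧ (m, w) ∉ M ∧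
    (¬ ManMatched M m ∨ ∃ w', (m, w') ∈ M ∧ I.prefA m w w') ∧
    (¬ WomanMatched M w ∨ ∃ m', (m', w) ∈ M ∧ I.prefB w m m')

/-- `(m,w)` is a `(−1,−1)` edge with respect to `M`: an edge of `E ∖ M` such that `m` is
matched and prefers his partner to `w`, and `w` is matched and prefers her partner to `m`. -/
def MinusMinus (I : CritInstance A B) (M : Finset (A × B)) (m : A) (w : B) : Prop :=
  (m, w) ∈ I.E ∧ (m, w) ∉ M ∧
    (∃ w', (m, w') ∈ M ∧ I.prefA m w' w) ∧
    (∃ m', (m', w) ∈ M ∧ I.prefB w m' m)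

/-- `M` is a stable matching: a matching with no blocking pair. -/
def IsStable (I : CritInstance A B) (M : Finset (A × B)) : Prop :=
  IsMatching I M ∧ ∀ m w, ¬ PlusPlus I M m w

/-- The min-size conditions for a level assignment `(lA, lB)` with respect to `M`:
(i) matched partners share a level, unmatched vertices have level 0, non-critical men
have level 0; (ii) every `(+1,+1)` edge goes from a man to a strictly higher level woman;
(iii) every edge from a man at level `i` to a woman at level `i − 1` is a `(−1,−1)` edge;
(iv) no edge goes from a man at level `i` to a woman at level `≤ i − 2`. -/
def MinSizeConds (I : CritInstance A B) (M : Finset (A × B))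
    (lA : A → ℕ) (lB : B → ℕ) : Prop :=
  (∀ m w, (m, w) ∈ M → lA m = lB w) ∧
  (∀ m, ¬ ManMatched M m → lA m = 0) ∧
  (∀ w, ¬ WomanMatched M w → lB w = 0) ∧
  (∀ m, m ∉ I.C → lA m = 0) ∧
  (∀ m w, PlusPlus I M m w → lA m < lB w) ∧
  (∀ m w, (m, w) ∈ I.E → lB w + 1 = lA m → MinusMinus I M m w) ∧
  (∀ m w, (m, w) ∈ I.E → ¬ (lB w + 2 ≤ lA m))

/-- The dominant conditions for a level assignment `(lA, lB)` with respect to `M`: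
(i) matched partners share a level, unmatched women have level 0, unmatched men have
level 1, non-critical men have level at most 1; (ii)–(iv) as in the min-size conditions. -/
def DomConds (I : CritInstance A B) (M : Finset (A × B))
    (lA : A → ℕ) (lB : B → ℕ) : Prop :=
  (∀ m w, (m, w) ∈ M → lA m = lB w) ∧
  (∀ m, ¬ ManMatched M m → lA m = 1) ∧
  (∀ w, ¬ WomanMatched M w → lB w = 0) ∧
  (∀ m, m ∉ I.C → lA m ≤ 1) ∧
  (∀ m w, PlusPlus I M m w → lA m < lB w) ∧
  (∀ m w, (m, w) ∈ I.E → lB w + 1 = lA m → MinusMinus I M m w) ∧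
  (∀ m w, (m, w) ∈ I.E → ¬ (lB w + 2 ≤ lA m))

/-- Adjacency in the bipartite graph, on the vertex set `A ⊕ B`. -/
def Adj (I : CritInstance A B) : A ⊕ B → A ⊕ B → Prop
  | Sum.inl m, Sum.inr w => (m, w) ∈ I.E
  | Sum.inr w, Sum.inl m => (m, w) ∈ I.E
  | _, _ => False

/-- The (directed) pair `(u, v)` of vertices spans an edge of the matching `M`. -/
def StepM (M : Finset (A × B)) : A ⊕ B → A ⊕ B → Prop
  | Sum.inl m, Sum.inr w => (m, w) ∈ M
  | Sum.inr w, Sum.inl m => (m, w) ∈ M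
  | _, _ => False

/-- The pair `(u, v)` of vertices spans a `(+1,+1)` edge with respect to `M`. -/
def StepPP (I : CritInstance A B) (M : Finset (A × B)) : A ⊕ B → A ⊕ B → Prop
  | Sum.inl m, Sum.inr w => PlusPlus I M m w
  | Sum.inr w, Sum.inl m => PlusPlus I M m w
  | _, _ => False

/-- The pair `(u, v)` of vertices spans a `(−1,−1)` edge with respect to `M`. -/
def StepMM (I : CritInstance A B) (M : Finset (A × B)) : A ⊕ B → A ⊕ B → Prop
  | Sum.inl m, Sum.inr w => MinusMinus I M m w
  | Sum.inr w, Sum.inl m => MinusMinus I M m w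
  | _, _ => False

/-- A vertex of `A ⊕ B` is matched in `M`. -/
def VMatched (M : Finset (A × B)) : A ⊕ B → Prop
  | Sum.inl m => ManMatched M m
  | Sum.inr w => WomanMatched M w

/-- An `M`-alternating path in the graph: a sequence of distinct vertices
`vert 0, …, vert len` (`len ≥ 1` edges), consecutive vertices adjacent, with
consecutive edges alternately inside and outside `M`. -/
structure AltPath (I : CritInstance A B) (M : Finset (A × B)) where
  len : ℕ
  len_pos : 0 < len
  vert : ℕ → A ⊕ B
  inj : ∀ i j, i ≤ len → j ≤ len → vert i = vert j → i = j
  adj : ∀ i, i < len → Adj I (vert i) (vert (i + 1))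
  alternate : ∀ i, i + 1 < len →
    (StepM M (vert i) (vert (i + 1)) ↔ ¬ StepM M (vert (i + 1)) (vert (i + 2)))

namespace AltPath

variable {I : CritInstance A B} {M : Finset (A × B)}

/-- The number of `(+1,+1)` edges of the path. -/
noncomputable def countPP (ρ : AltPath I M) : ℕ :=
  ((Finset.range ρ.len).filter fun i => StepPP I M (ρ.vert i) (ρ.vert (i + 1))).card

/-- The number of `(−1,−1)` edges of the path. -/
noncomputable def countMM (ρ : AltPath I M) : ℕ :=
  ((Finset.range ρ.len).filter fun i => StepMM I M (ρ.vert i) (ρ.vert (i + 1))).card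

/-- The vertex `u` lies on the path. -/
def Mem (ρ : AltPath I M) (u : A ⊕ B) : Prop := ∃ i ≤ ρ.len, ρ.vert i = u

/-- The set of edges of the path, as a set of pairs in `A × B`. -/
noncomputable def edges (ρ : AltPath I M) : Finset (A × B) :=
  I.E.filter fun e => ∃ i < ρ.len,
    (ρ.vert i = Sum.inl e.1 ∧ ρ.vert (i + 1) = Sum.inr e.2) ∨
    (ρ.vert i = Sum.inr e.2 ∧ ρ.vert (i + 1) = Sum.inl e.1)

end AltPath

/-- An `M`-alternating cycle: a closed sequence of vertices `vert 0, …, vert len = vert 0`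
(distinct except for the return), consecutive vertices adjacent, with edges alternately
inside and outside `M`, including around the wrap. -/
structure AltCycle (I : CritInstance A B) (M : Finset (A × B)) where
  len : ℕ
  len_pos : 0 < len
  vert : ℕ → A ⊕ B
  closed : vert len = vert 0
  inj : ∀ i j, i < len → j < len → vert i = vert j → i = j
  adj : ∀ i, i < len → Adj I (vert i) (vert (i + 1))
  alternate : ∀ i, i + 1 < len →
    (StepM M (vert i) (vert (i + 1)) ↔ ¬ StepM M (vert (i + 1)) (vert (i + 2)))
  alternate_wrap : StepM M (vert (len - 1)) (vert len) ↔ ¬ StepM M (vert 0) (vert 1)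

namespace AltCycle

variable {I : CritInstance A B} {M : Finset (A × B)}

/-- The number of `(+1,+1)` edges of the cycle. -/
noncomputable def countPP (σ : AltCycle I M) : ℕ :=
  ((Finset.range σ.len).filter fun i => StepPP I M (σ.vert i) (σ.vert (i + 1))).card

/-- The number of `(−1,−1)` edges of the cycle. -/
noncomputable def countMM (σ : AltCycle I M) : ℕ :=
  ((Finset.range σ.len).filter fun i => StepMM I M (σ.vert i) (σ.vert (i + 1))).card

end AltCycle

/-- A size-increasing alternating path (SIAP) for `M`: an `M`-alternating path whose two
endpoints are a man unmatched in `M` and a woman unmatched in `M`, and which has equally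
many `(+1,+1)` and `(−1,−1)` edges. -/
def IsSIAP (I : CritInstance A B) (M : Finset (A × B)) (ρ : AltPath I M) : Prop :=
  (((∃ m, ρ.vert 0 = Sum.inl m ∧ ¬ ManMatched M m) ∧
      (∃ w, ρ.vert ρ.len = Sum.inr w ∧ ¬ WomanMatched M w)) ∨
    ((∃ w, ρ.vert 0 = Sum.inr w ∧ ¬ WomanMatched M w) ∧
      (∃ m, ρ.vert ρ.len = Sum.inl m ∧ ¬ ManMatched M m))) ∧
  ρ.countPP = ρ.countMM

/-- A size-reducing alternating path (SRAP) for `M` with respect to the level assignment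
`(lA, lB)`: an `M`-alternating path both of whose terminal edges lie in `M`, starting at a
woman matched in `M` at level 0, ending at a non-critical man at level 1, whose number of
`(+1,+1)` edges is exactly one more than its number of `(−1,−1)` edges. -/
def IsSRAP (I : CritInstance A B) (M : Finset (A × B)) (lA : A → ℕ) (lB : B → ℕ)
    (ρ : AltPath I M) : Prop :=
  StepM M (ρ.vert 0) (ρ.vert 1) ∧
  StepM M (ρ.vert (ρ.len - 1)) (ρ.vert ρ.len) ∧
  (((∃ w, ρ.vert 0 = Sum.inr w ∧ WomanMatched M w ∧ lB w = 0) ∧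
      (∃ m, ρ.vert ρ.len = Sum.inl m ∧ m ∉ I.C ∧ lA m = 1)) ∨
    ((∃ m, ρ.vert 0 = Sum.inl m ∧ m ∉ I.C ∧ lA m = 1) ∧
      (∃ w, ρ.vert ρ.len = Sum.inr w ∧ WomanMatched M w ∧ lB w = 0))) ∧
  ρ.countPP = ρ.countMM + 1

end CritInstance

namespace CritInstance

variable {A : Type u} {B : Type v}

/-- The edges of `X` outside the set of women `T`, together with the edges of `Y` inside `T`. -/
noncomputable def switch (X Y : Finset (A × B)) (T : Set B) : Finset (A × B) :=
  (X.filter fun e => e.2 ∉ T) ∪ (Y.filter fun e => e.2 ∈ T)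

/-- No edge of `X` joins `R ∪ T` to its complement. -/
def IsClosedPair (X : Finset (A × B)) (R : Set A) (T : Set B) : Prop :=
  ∀ ⦃m w⦄, (m, w) ∈ X → (m ∈ R ↔ w ∈ T)

section Switch

variable {I : CritInstance A B} {X Y : Finset (A × B)} {R : Set A} {T : Set B}

lemma mem_switch {e : A × B} :
    e ∈ switch X Y T ↔ (e ∈ X ∧ e.2 ∉ T) ∨ (e ∈ Y ∧ e.2 ∈ T) := by
  simp [switch]

lemma mem_switch_of_woman_mem {m : A} {w : B} (hw : w ∈ T) :
    (m, w) ∈ switch X Y T ↔ (m, w) ∈ Y := by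
  simp [mem_switch, hw]

lemma mem_switch_of_woman_notMem {m : A} {w : B} (hw : w ∉ T) :
    (m, w) ∈ switch X Y T ↔ (m, w) ∈ X := by
  simp [mem_switch, hw]

lemma mem_switch_of_man_mem (hX : IsClosedPair X R T) (hY : IsClosedPair Y R T)
    {m : A} (hm : m ∈ R) (w : B) : (m, w) ∈ switch X Y T ↔ (m, w) ∈ Y := by
  have h₁ := @hX m w
  have h₂ := @hY m w
  rw [mem_switch]
  tauto

lemma mem_switch_of_man_notMem (hX : IsClosedPair X R T) (hY : IsClosedPair Y R T)
    {m : A} (hm : m ∉ R) (w : B) : (m, w) ∈ switch X Y T ↔ (m, w) ∈ X := by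
  have h₁ := @hX m w
  have h₂ := @hY m w
  rw [mem_switch]
  tauto

lemma IsFeasible.switch (hXf : I.IsFeasible X) (hYf : I.IsFeasible Y)
    (hX : IsClosedPair X R T) (hY : IsClosedPair Y R T) :
    I.IsFeasible (switch X Y T) := by
  obtain ⟨⟨hXE, hX₁, hX₂⟩, hXC⟩ := hXf
  obtain ⟨⟨hYE, hY₁, hY₂⟩, hYC⟩ := hYf
  refine ⟨⟨?_, ?_, ?_⟩, ?_⟩
  · intro e he
    rcases mem_switch.1 he with h | h
    exacts [hXE h.1, hYE h.1]
  · intro m w w' h h'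
    by_cases hm : m ∈ R
    · rw [mem_switch_of_man_mem hX hY hm] at h h'
      exact hY₁ h h'
    · rw [mem_switch_of_man_notMem hX hY hm] at h h'
      exact hX₁ h h'
  · intro m m' w h h'
    by_cases hw : w ∈ T
    · rw [mem_switch_of_woman_mem hw] at h h'
      exact hY₂ h h'
    · rw [mem_switch_of_woman_notMem hw] at h h'
      exact hX₂ h h'
  · intro m hmC
    by_cases hm : m ∈ R
    · simpa only [ManMatched, mem_switch_of_man_mem hX hY hm] using hYC m hmC
    · simpa only [ManMatched, mem_switch_of_man_notMem hX hY hm] using hXC m hmC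

lemma not_manPrefers_self (h : I.IsMatching X) (m : A) : ¬ ManPrefers I X X m := by
  rintro ⟨w, hw, hn | ⟨w', hw', hp⟩⟩
  · exact hn ⟨w, hw⟩
  · rw [h.2.1 hw hw'] at hp
    exact I.prefA_irrefl _ _ hp

lemma not_womanPrefers_self (h : I.IsMatching X) (w : B) : ¬ WomanPrefers I X X w := by
  rintro ⟨m, hm, hn | ⟨m', hm', hp⟩⟩
  · exact hn ⟨m, hm⟩
  · rw [h.2.2 hm hm'] at hp
    exact I.prefB_irrefl _ _ hp

variable [Fintype A] [Fintype B]

/-- The number of vertices of `R ∪ T` that prefer `X` to `Y`. -/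
noncomputable def phiOn (I : CritInstance A B) (R : Set A) (T : Set B)
    (X Y : Finset (A × B)) : ℕ :=
  (Finset.univ.filter fun m : A => m ∈ R ∧ ManPrefers I X Y m).card +
    (Finset.univ.filter fun w : B => w ∈ T ∧ WomanPrefers I X Y w).card

lemma phi_switch_left (hXm : I.IsMatching X) (hX : IsClosedPair X R T)
    (hY : IsClosedPair Y R T) : phi I (switch X Y T) X = phiOn I R T Y X := by
  unfold phi phiOn
  congr 2
  · ext m
    simp only [Finset.mem_filter, Finset.mem_univ, true_and]
    by_cases hm : m ∈ R
    · simp [ManPrefers, mem_switch_of_man_mem hX hY hm, hm]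
    · have := not_manPrefers_self hXm m
      simpa [ManPrefers, mem_switch_of_man_notMem hX hY hm, hm] using this
  · ext w
    simp only [Finset.mem_filter, Finset.mem_univ, true_and]
    by_cases hw : w ∈ T
    · simp [WomanPrefers, mem_switch_of_woman_mem hw, hw]
    · have := not_womanPrefers_self hXm w
      simpa [WomanPrefers, mem_switch_of_woman_notMem hw, hw] using this

lemma phi_switch_right (hXm : I.IsMatching X) (hX : IsClosedPair X R T)
    (hY : IsClosedPair Y R T) : phi I X (switch X Y T) = phiOn I R T X Y := by
  unfold phi phiOn
  congr 2
  · ext m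
    simp only [Finset.mem_filter, Finset.mem_univ, true_and]
    by_cases hm : m ∈ R
    · simp [ManPrefers, ManMatched, mem_switch_of_man_mem hX hY hm, hm]
    · have := not_manPrefers_self hXm m
      simpa [ManPrefers, ManMatched, mem_switch_of_man_notMem hX hY hm, hm] using this
  · ext w
    simp only [Finset.mem_filter, Finset.mem_univ, true_and]
    by_cases hw : w ∈ T
    · simp [WomanPrefers, WomanMatched, mem_switch_of_woman_mem hw, hw]
    · have := not_womanPrefers_self hXm w
      simpa [WomanPrefers, WomanMatched, mem_switch_of_woman_notMem hw, hw] using this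

lemma IsPFM.phiOn_le (hXp : I.IsPFM X) (hYf : I.IsFeasible Y) (hX : IsClosedPair X R T)
    (hY : IsClosedPair Y R T) : phiOn I R T Y X ≤ phiOn I R T X Y := by
  rw [← phi_switch_left hXp.1.1 hX hY, ← phi_switch_right hXp.1.1 hX hY]
  exact hXp.2 _ (hXp.1.switch hYf hX hY)

end Switch

/-- The alternating walk `w 0, m 0, w 1, m 1, …, w k`, beginning with an edge of `M` at a woman
unmatched in `N`, with edges `(m i, w i)` in `M` and `(m i, w (i + 1))` in `N`. -/
structure IsChain (M N : Finset (A × B)) (k : ℕ) (w : ℕ → B) (m : ℕ → A) : Prop where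
  start : ¬ WomanMatched N (w 0)
  start_matched : WomanMatched M (w 0)
  mem_left : ∀ i < k, (m i, w i) ∈ M
  mem_right : ∀ i < k, (m i, w (i + 1)) ∈ N

lemma IsChain.extend {M N : Finset (A × B)} {k : ℕ} {w : ℕ → B} {m : ℕ → A}
    (h : IsChain M N k w m) {a : A} {b : B} (hM : (a, w k) ∈ M) (hN : (a, b) ∈ N) :
    IsChain M N (k + 1) (fun i => if i ≤ k then w i else b) (fun i => if i < k then m i else a) := by
  refine ⟨by simpa using h.start, by simpa using h.start_matched, ?_, ?_⟩
  · intro i hi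
    rcases Nat.lt_succ_iff_lt_or_eq.1 hi with hi | rfl
    · simpa [hi, hi.le] using h.mem_left i hi
    · simpa using hM
  · intro i hi
    rcases Nat.lt_succ_iff_lt_or_eq.1 hi with hi | rfl
    · simpa [hi, Nat.succ_le_of_lt hi] using h.mem_right i hi
    · simpa using hN

lemma IsMatching.card_filter_womanMatched [Fintype B] {I : CritInstance A B}
    {M : Finset (A × B)} (h : I.IsMatching M) :
    (Finset.univ.filter fun w : B => WomanMatched M w).card = M.card := by
  have : (Finset.univ.filter fun w : B => WomanMatched M w) = M.image Prod.snd := by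
    ext w
    simp only [Finset.mem_filter, Finset.mem_univ, true_and]
    simp [WomanMatched]
  rw [this, Finset.card_image_of_injOn]
  rintro ⟨a, b⟩ he ⟨a', b'⟩ he' (rfl : b = b')
  rw [h.2.2 he he']

/-- If `N` is smaller than `M`, then some alternating walk beginning with an edge of `M` at a woman
unmatched in `N` ends with an edge of `M` at a man unmatched in `N`. -/
lemma exists_isChain_of_card_lt [Fintype A] [Fintype B] {I : CritInstance A B}
    {M N : Finset (A × B)} (hM : I.IsMatching M) (hN : I.IsMatching N) (hlt : N.card < M.card) :
    ∃ k w m, IsChain M N k w m ∧ ∃ a, (a, w k) ∈ M ∧ ¬ ManMatched N a := by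
  by_contra! hcon
  let S : Set B := {b | ∃ k w m, IsChain M N k w m ∧ w k = b}
  have hnext : ∀ b, b ∈ S → WomanMatched M b →
      ∃ b' ∈ S, ∃ a, (a, b) ∈ M ∧ (a, b') ∈ N := by
    rintro _ ⟨k, w, m, h, rfl⟩ ⟨a, ha⟩
    obtain ⟨b', hb'⟩ := hcon k w m h a ha
    exact ⟨b', ⟨k + 1, _, _, h.extend ha hb', by simp⟩, a, ha, hb'⟩
  have hsub : ∀ b ∈ S, WomanMatched M b ∨ WomanMatched N b := by
    rintro _ ⟨k, w, m, h, rfl⟩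
    cases k with
    | zero => exact Or.inl h.start_matched
    | succ k => exact Or.inr ⟨_, h.mem_right k k.lt_succ_self⟩
  have hstart : ∀ b, WomanMatched M b → ¬ WomanMatched N b → b ∈ S := fun b h₁ h₂ =>
    ⟨0, fun _ => b, fun _ => h₁.choose, ⟨h₂, h₁, by simp, by simp⟩, rfl⟩
  choose! g hgS hg using hnext
  let WM := Finset.univ.filter fun w : B => WomanMatched M w
  let WN := Finset.univ.filter fun w : B => WomanMatched N w
  let U := Finset.univ.filter fun w : B => w ∈ S
  have hinj : (U ∩ WM).card ≤ (U ∩ WN).card := by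
    refine Finset.card_le_card_of_injOn g ?_ ?_
    · intro b hb
      simp only [U, WM, WN, Finset.coe_inter, Finset.coe_filter, Finset.mem_univ, true_and,
        Set.mem_inter_iff, Set.mem_ofPred_eq] at hb ⊢
      obtain ⟨a, -, ha⟩ := hg b hb.1 hb.2
      exact ⟨hgS b hb.1 hb.2, a, ha⟩
    · intro b hb b' hb' heq
      simp only [U, WM, Finset.coe_inter, Finset.coe_filter, Finset.mem_univ, true_and,
        Set.mem_inter_iff, Set.mem_ofPred_eq] at hb hb'
      obtain ⟨a, ha, ha'⟩ := hg b hb.1 hb.2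
      obtain ⟨c, hc, hc'⟩ := hg b' hb'.1 hb'.2
      rw [← heq] at hc'
      obtain rfl := hN.2.2 ha' hc'
      exact hM.2.1 ha hc
  have hout : (WM \ U).card ≤ (WN \ U).card := by
    refine Finset.card_le_card fun b hb => ?_
    simp only [U, WM, WN, Finset.mem_sdiff, Finset.mem_filter, Finset.mem_univ, true_and] at hb ⊢
    refine ⟨?_, hb.2⟩
    by_contra h
    exact hb.2 (hstart b hb.1 h)
  have h₁ := Finset.card_inter_add_card_sdiff WM U
  have h₂ := Finset.card_inter_add_card_sdiff WN U
  rw [Finset.inter_comm] at h₁ h₂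
  have h₃ : WM.card = M.card := hM.card_filter_womanMatched
  have h₄ : WN.card = N.card := hN.card_filter_womanMatched
  omega

/-- A component of the symmetric difference of `M` and `N` that is a path whose terminal edges
both lie in `M`: the edges `(m i, w i)` lie in `M`, the edges `(m i, w (i + 1))` lie in `N`. -/
structure IsMPath (M N : Finset (A × B)) (k : ℕ) (w : ℕ → B) (m : ℕ → A) : Prop where
  start : ¬ WomanMatched N (w 0)
  finish : ¬ ManMatched N (m k)
  mem_left : ∀ i ≤ k, (m i, w i) ∈ M
  mem_right : ∀ i < k, (m i, w (i + 1)) ∈ N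

lemma exists_isMPath_of_card_lt [Fintype A] [Fintype B] {I : CritInstance A B}
    {M N : Finset (A × B)} (hM : I.IsMatching M) (hN : I.IsMatching N) (hlt : N.card < M.card) :
    ∃ k w m, IsMPath M N k w m := by
  obtain ⟨k, w, m, h, a, ha, haN⟩ := exists_isChain_of_card_lt hM hN hlt
  refine ⟨k, w, fun i => if i < k then m i else a, h.start, by simpa using haN, ?_, ?_⟩
  · intro i hi
    rcases hi.lt_or_eq with hi | rfl
    · simpa [hi] using h.mem_left i hi
    · simpa using ha
  · intro i hi
    simpa [hi] using h.mem_right i hi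

namespace IsMPath

variable {I : CritInstance A B} {M N : Finset (A × B)} {k : ℕ} {w : ℕ → B} {m : ℕ → A}

lemma woman_ne (h : IsMPath M N k w m) (hM : I.IsMatching M) (hN : I.IsMatching N) :
    ∀ i j, i < j → j ≤ k → w i ≠ w j := by
  intro i
  induction i with
  | zero =>
    intro j hj hjk heq
    obtain ⟨j, rfl⟩ : ∃ j', j = j' + 1 := ⟨j - 1, by omega⟩
    exact h.start ⟨m j, heq ▸ h.mem_right j (by omega)⟩
  | succ i ih =>
    intro j hj hjk heq
    obtain ⟨j, rfl⟩ : ∃ j', j = j' + 1 := ⟨j - 1, by omega⟩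
    have h₁ := h.mem_right i (by omega)
    rw [heq] at h₁
    have h₂ := hN.2.2 h₁ (h.mem_right j (by omega))
    have h₃ := h.mem_left i (by omega)
    rw [h₂] at h₃
    exact ih j (by omega) (by omega) (hM.2.1 h₃ (h.mem_left j (by omega)))

lemma woman_inj (h : IsMPath M N k w m) (hM : I.IsMatching M) (hN : I.IsMatching N)
    {i j : ℕ} (hi : i ≤ k) (hj : j ≤ k) (heq : w i = w j) : i = j := by
  rcases lt_trichotomy i j with hij | hij | hij
  · exact absurd heq (h.woman_ne hM hN i j hij hj)
  · exact hij
  · exact absurd heq.symm (h.woman_ne hM hN j i hij hi)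

lemma man_inj (h : IsMPath M N k w m) (hM : I.IsMatching M) (hN : I.IsMatching N)
    {i j : ℕ} (hi : i ≤ k) (hj : j ≤ k) (heq : m i = m j) : i = j := by
  have h₁ := h.mem_left i hi
  rw [heq] at h₁
  exact h.woman_inj hM hN hi hj (hM.2.1 h₁ (h.mem_left j hj))

lemma right_notMem (h : IsMPath M N k w m) (hM : I.IsMatching M) (hN : I.IsMatching N)
    {i : ℕ} (hi : i < k) : (m i, w (i + 1)) ∉ M := fun hmem => by
  have := h.woman_inj hM hN (by omega) (by omega) (hM.2.1 hmem (h.mem_left i hi.le))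
  omega

/-- The men of the path. -/
def men (k : ℕ) (m : ℕ → A) : Set A := {a | ∃ i ≤ k, m i = a}

/-- The women of the path. -/
def women (k : ℕ) (w : ℕ → B) : Set B := {b | ∃ i ≤ k, w i = b}

lemma isClosedPair_left (h : IsMPath M N k w m) (hM : I.IsMatching M) :
    IsClosedPair M (men k m) (women k w) := by
  intro a b hab
  constructor
  · rintro ⟨i, hi, rfl⟩
    exact ⟨i, hi, hM.2.1 (h.mem_left i hi) hab⟩
  · rintro ⟨i, hi, rfl⟩
    exact ⟨i, hi, hM.2.2 (h.mem_left i hi) hab⟩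

lemma isClosedPair_right (h : IsMPath M N k w m) (hN : I.IsMatching N) :
    IsClosedPair N (men k m) (women k w) := by
  intro a b hab
  constructor
  · rintro ⟨i, hi, rfl⟩
    rcases hi.lt_or_eq with hi | rfl
    · exact ⟨i + 1, hi, hN.2.1 (h.mem_right i hi) hab⟩
    · exact absurd ⟨b, hab⟩ h.finish
  · rintro ⟨i, hi, rfl⟩
    cases i with
    | zero => exact absurd ⟨a, hab⟩ h.start
    | succ i => exact ⟨i, by omega, hN.2.2 (h.mem_right i (by omega)) hab⟩

lemma manPrefers_right_iff (h : IsMPath M N k w m) (hM : I.IsMatching M) (hN : I.IsMatching N)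
    {i : ℕ} (hi : i < k) : ManPrefers I N M (m i) ↔ I.prefA (m i) (w (i + 1)) (w i) := by
  constructor
  · rintro ⟨b, hb, hn | ⟨b', hb', hp⟩⟩
    · exact absurd ⟨_, h.mem_left i hi.le⟩ hn
    · rwa [hN.2.1 hb (h.mem_right i hi), hM.2.1 hb' (h.mem_left i hi.le)] at hp
  · exact fun hp => ⟨_, h.mem_right i hi, Or.inr ⟨_, h.mem_left i hi.le, hp⟩⟩

lemma manPrefers_left_iff (h : IsMPath M N k w m) (hM : I.IsMatching M) (hN : I.IsMatching N)
    {i : ℕ} (hi : i < k) : ManPrefers I M N (m i) ↔ I.prefA (m i) (w i) (w (i + 1)) := by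
  constructor
  · rintro ⟨b, hb, hn | ⟨b', hb', hp⟩⟩
    · exact absurd ⟨_, h.mem_right i hi⟩ hn
    · rwa [hN.2.1 hb' (h.mem_right i hi), hM.2.1 hb (h.mem_left i hi.le)] at hp
  · exact fun hp => ⟨_, h.mem_left i hi.le, Or.inr ⟨_, h.mem_right i hi, hp⟩⟩

lemma womanPrefers_right_iff (h : IsMPath M N k w m) (hM : I.IsMatching M)
    (hN : I.IsMatching N) {i : ℕ} (hi : i < k) :
    WomanPrefers I N M (w (i + 1)) ↔ I.prefB (w (i + 1)) (m i) (m (i + 1)) := by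
  constructor
  · rintro ⟨b, hb, hn | ⟨b', hb', hp⟩⟩
    · exact absurd ⟨_, h.mem_left (i + 1) hi⟩ hn
    · rwa [hN.2.2 hb (h.mem_right i hi), hM.2.2 hb' (h.mem_left (i + 1) hi)] at hp
  · exact fun hp => ⟨_, h.mem_right i hi, Or.inr ⟨_, h.mem_left (i + 1) hi, hp⟩⟩

lemma womanPrefers_left_iff (h : IsMPath M N k w m) (hM : I.IsMatching M)
    (hN : I.IsMatching N) {i : ℕ} (hi : i < k) :
    WomanPrefers I M N (w (i + 1)) ↔ I.prefB (w (i + 1)) (m (i + 1)) (m i) := by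
  constructor
  · rintro ⟨b, hb, hn | ⟨b', hb', hp⟩⟩
    · exact absurd ⟨_, h.mem_right i hi⟩ hn
    · rwa [hN.2.2 hb' (h.mem_right i hi), hM.2.2 hb (h.mem_left (i + 1) hi)] at hp
  · exact fun hp => ⟨_, h.mem_left (i + 1) hi, Or.inr ⟨_, h.mem_right i hi, hp⟩⟩

lemma not_prefA_iff (h : IsMPath M N k w m) (hM : I.IsMatching M) (hN : I.IsMatching N)
    {i : ℕ} (hi : i < k) :
    ¬ I.prefA (m i) (w (i + 1)) (w i) ↔ I.prefA (m i) (w i) (w (i + 1)) := by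
  have hne := h.woman_ne hM hN i (i + 1) i.lt_succ_self hi
  have := I.prefA_total (m i) _ _ (hM.1 (h.mem_left i hi.le)) (hN.1 (h.mem_right i hi)) hne
  have := fun h₁ h₂ => I.prefA_irrefl _ _ (I.prefA_trans (m i) (w i) (w (i + 1)) (w i) h₁ h₂)
  tauto

lemma not_prefB_iff (h : IsMPath M N k w m) (hM : I.IsMatching M) (hN : I.IsMatching N)
    {i : ℕ} (hi : i < k) :
    ¬ I.prefB (w (i + 1)) (m i) (m (i + 1)) ↔ I.prefB (w (i + 1)) (m (i + 1)) (m i) := by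
  have hne : m (i + 1) ≠ m i := fun heq => by
    have := h.man_inj hM hN hi hi.le heq
    omega
  have := I.prefB_total (w (i + 1)) _ _ (hM.1 (h.mem_left (i + 1) hi)) (hN.1 (h.mem_right i hi)) hne
  have := fun h₁ h₂ =>
    I.prefB_irrefl _ _ (I.prefB_trans (w (i + 1)) (m i) (m (i + 1)) (m i) h₁ h₂)
  tauto

lemma plusPlus_iff (h : IsMPath M N k w m) (hM : I.IsMatching M) (hN : I.IsMatching N)
    {i : ℕ} (hi : i < k) : PlusPlus I M (m i) (w (i + 1)) ↔
      I.prefA (m i) (w (i + 1)) (w i) ∧ I.prefB (w (i + 1)) (m i) (m (i + 1)) := by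
  constructor
  · rintro ⟨-, -, h₁ | ⟨b, hb, h₁⟩, h₂ | ⟨a, ha, h₂⟩⟩
    · exact absurd ⟨_, h.mem_left i hi.le⟩ h₁
    · exact absurd ⟨_, h.mem_left i hi.le⟩ h₁
    · exact absurd ⟨_, h.mem_left (i + 1) hi⟩ h₂
    · rw [hM.2.1 hb (h.mem_left i hi.le)] at h₁
      rw [hM.2.2 ha (h.mem_left (i + 1) hi)] at h₂
      exact ⟨h₁, h₂⟩
  · exact fun hp => ⟨hN.1 (h.mem_right i hi), h.right_notMem hM hN hi,
      Or.inr ⟨_, h.mem_left i hi.le, hp.1⟩, Or.inr ⟨_, h.mem_left (i + 1) hi, hp.2⟩⟩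

lemma minusMinus_iff (h : IsMPath M N k w m) (hM : I.IsMatching M) (hN : I.IsMatching N)
    {i : ℕ} (hi : i < k) : MinusMinus I M (m i) (w (i + 1)) ↔
      ¬ I.prefA (m i) (w (i + 1)) (w i) ∧ ¬ I.prefB (w (i + 1)) (m i) (m (i + 1)) := by
  rw [h.not_prefA_iff hM hN hi, h.not_prefB_iff hM hN hi]
  constructor
  · rintro ⟨-, -, ⟨b, hb, h₁⟩, ⟨a, ha, h₂⟩⟩
    rw [hM.2.1 hb (h.mem_left i hi.le)] at h₁
    rw [hM.2.2 ha (h.mem_left (i + 1) hi)] at h₂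
    exact ⟨h₁, h₂⟩
  · exact fun hp => ⟨hN.1 (h.mem_right i hi), h.right_notMem hM hN hi,
      ⟨_, h.mem_left i hi.le, hp.1⟩, ⟨_, h.mem_left (i + 1) hi, hp.2⟩⟩

lemma card_filter_mem_image {α : Type*} [Fintype α] {k : ℕ} {f : ℕ → α} {S : Set α}
    (hS : ∀ a, a ∈ S ↔ ∃ i ≤ k, f i = a) (hf : ∀ i j, i ≤ k → j ≤ k → f i = f j → i = j)
    (P : α → Prop) :
    (Finset.univ.filter fun a => a ∈ S ∧ P a).card =
      ∑ i ∈ Finset.range (k + 1), if P (f i) then 1 else 0 := by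
  rw [← Finset.card_filter, ← Finset.card_image_of_injOn (f := f)]
  · congr 1
    ext a
    simp only [Finset.mem_filter, Finset.mem_univ, true_and, Finset.mem_image, Finset.mem_range,
      Nat.lt_succ_iff, hS]
    constructor
    · rintro ⟨⟨i, hi, rfl⟩, hP⟩
      exact ⟨i, ⟨hi, hP⟩, rfl⟩
    · rintro ⟨i, ⟨hi, hP⟩, rfl⟩
      exact ⟨⟨i, hi, rfl⟩, hP⟩
  · intro i hi j hj
    simp only [Finset.coe_filter, Finset.mem_range, Set.mem_ofPred_eq] at hi hj
    exact hf i j (by omega) (by omega)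

lemma phiOn_right [Fintype A] [Fintype B] (h : IsMPath M N k w m) (hM : I.IsMatching M)
    (hN : I.IsMatching N) : phiOn I (men k m) (women k w) N M =
      ∑ i ∈ Finset.range k, ((if I.prefA (m i) (w (i + 1)) (w i) then 1 else 0) +
        if I.prefB (w (i + 1)) (m i) (m (i + 1)) then 1 else 0) := by
  have hlast : ¬ ManPrefers I N M (m k) := fun ⟨b, hb, _⟩ => h.finish ⟨b, hb⟩
  have hfirst : ¬ WomanPrefers I N M (w 0) := fun ⟨a, ha, _⟩ => h.start ⟨a, ha⟩
  rw [phiOn, card_filter_mem_image (S := men k m) (fun _ => Iff.rfl) fun i j => h.man_inj hM hN,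
    card_filter_mem_image (S := women k w) (fun _ => Iff.rfl)
      fun i j => h.woman_inj hM hN, Finset.sum_range_succ,
    Finset.sum_range_succ', if_neg hlast, if_neg hfirst, add_zero, add_zero,
    ← Finset.sum_add_distrib]
  refine Finset.sum_congr rfl fun i hi => ?_
  have hi := Finset.mem_range.1 hi
  simp only [h.manPrefers_right_iff hM hN hi, h.womanPrefers_right_iff hM hN hi]

lemma phiOn_left [Fintype A] [Fintype B] (h : IsMPath M N k w m) (hM : I.IsMatching M)
    (hN : I.IsMatching N) : phiOn I (men k m) (women k w) M N =
      (∑ i ∈ Finset.range k, ((if I.prefA (m i) (w (i + 1)) (w i) then 0 else 1) +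
        if I.prefB (w (i + 1)) (m i) (m (i + 1)) then 0 else 1)) + 2 := by
  have hlast : ManPrefers I M N (m k) := ⟨_, h.mem_left k le_rfl, Or.inl h.finish⟩
  have hfirst : WomanPrefers I M N (w 0) := ⟨_, h.mem_left 0 k.zero_le, Or.inl h.start⟩
  rw [phiOn, card_filter_mem_image (S := men k m) (fun _ => Iff.rfl) fun i j => h.man_inj hM hN,
    card_filter_mem_image (S := women k w) (fun _ => Iff.rfl)
      fun i j => h.woman_inj hM hN, Finset.sum_range_succ,
    Finset.sum_range_succ', if_pos hlast, if_pos hfirst, add_add_add_comm,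
    ← Finset.sum_add_distrib]
  congr 1
  refine Finset.sum_congr rfl fun i hi => ?_
  have hi := Finset.mem_range.1 hi
  simp only [h.manPrefers_left_iff hM hN hi, h.womanPrefers_left_iff hM hN hi,
    ← h.not_prefA_iff hM hN hi, ← h.not_prefB_iff hM hN hi, ite_not]

/-- The vertices of the path, in order. -/
def vert (w : ℕ → B) (m : ℕ → A) (n : ℕ) : A ⊕ B :=
  if n % 2 = 0 then Sum.inr (w (n / 2)) else Sum.inl (m (n / 2))

lemma vert_even (i : ℕ) : vert w m (2 * i) = Sum.inr (w i) := by
  simp [vert]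

lemma vert_odd (i : ℕ) : vert w m (2 * i + 1) = Sum.inl (m i) := by
  have h₁ : (2 * i + 1) % 2 = 1 := by omega
  have h₂ : (2 * i + 1) / 2 = i := by omega
  simp [vert, h₁, h₂]

lemma vert_odd_succ (i : ℕ) : vert w m (2 * i + 1 + 1) = Sum.inr (w (i + 1)) :=
  vert_even (i + 1)

/-- The path as an `M`-alternating path. -/
def toAltPath (h : IsMPath M N k w m) (hM : I.IsMatching M) (hN : I.IsMatching N) :
    AltPath I M where
  len := 2 * k + 1
  len_pos := Nat.succ_pos _
  vert := vert w m
  inj i j hi hj heq := by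
    rcases Nat.even_or_odd' i with ⟨i, rfl | rfl⟩ <;>
      rcases Nat.even_or_odd' j with ⟨j, rfl | rfl⟩ <;>
      simp only [vert_even, vert_odd, Sum.inl.injEq, Sum.inr.injEq, reduceCtorEq] at heq
    · rw [h.woman_inj hM hN (by omega) (by omega) heq]
    · rw [h.man_inj hM hN (by omega) (by omega) heq]
  adj i hi := by
    rcases Nat.even_or_odd' i with ⟨i, rfl | rfl⟩
    · rw [vert_even, vert_odd]
      exact hM.1 (h.mem_left i (by omega))
    · rw [vert_odd, vert_odd_succ]
      exact hN.1 (h.mem_right i (by omega))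
  alternate i hi := by
    rcases Nat.even_or_odd' i with ⟨i, rfl | rfl⟩
    · rw [vert_even, vert_odd, show 2 * i + 2 = 2 * (i + 1) by ring, vert_even]
      exact iff_of_true (h.mem_left i (by omega)) (h.right_notMem hM hN (by omega))
    · rw [vert_odd, vert_odd_succ, show 2 * i + 1 + 2 = 2 * (i + 1) + 1 by ring, vert_odd]
      exact iff_of_false (h.right_notMem hM hN (by omega))
        (not_not_intro (h.mem_left (i + 1) (by omega)))

lemma sum_range_two_mul (f : ℕ → ℕ) (k : ℕ) : ∑ i ∈ Finset.range (2 * k + 1), f i =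
    (∑ i ∈ Finset.range k, f (2 * i + 1)) + ∑ i ∈ Finset.range (k + 1), f (2 * i) := by
  induction k with
  | zero => simp
  | succ k ih =>
    rw [show 2 * (k + 1) + 1 = 2 * k + 1 + 1 + 1 by ring, Finset.sum_range_succ,
      Finset.sum_range_succ, ih, Finset.sum_range_succ (fun i => f (2 * i + 1)),
      Finset.sum_range_succ (fun i => f (2 * i)) (k + 1),
      show 2 * (k + 1) = 2 * k + 1 + 1 by ring]
    ring

lemma countPP_toAltPath (h : IsMPath M N k w m) (hM : I.IsMatching M) (hN : I.IsMatching N) :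
    (h.toAltPath hM hN).countPP = ∑ i ∈ Finset.range k,
      if I.prefA (m i) (w (i + 1)) (w i) ∧ I.prefB (w (i + 1)) (m i) (m (i + 1))
        then 1 else 0 := by
  rw [AltPath.countPP, Finset.card_filter]
  change (∑ i ∈ Finset.range (2 * k + 1),
    if StepPP I M (vert w m i) (vert w m (i + 1)) then 1 else 0) = _
  rw [sum_range_two_mul, Finset.sum_eq_zero (s := Finset.range (k + 1)), add_zero]
  · refine Finset.sum_congr rfl fun i hi => ?_
    rw [vert_odd, vert_odd_succ]
    simp only [StepPP, h.plusPlus_iff hM hN (Finset.mem_range.1 hi)]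
  · intro i hi
    rw [vert_even, vert_odd]
    exact if_neg fun hp => hp.2.1 (h.mem_left i (by simpa [Nat.lt_succ_iff] using hi))

lemma countMM_toAltPath (h : IsMPath M N k w m) (hM : I.IsMatching M) (hN : I.IsMatching N) :
    (h.toAltPath hM hN).countMM = ∑ i ∈ Finset.range k,
      if ¬ I.prefA (m i) (w (i + 1)) (w i) ∧ ¬ I.prefB (w (i + 1)) (m i) (m (i + 1))
        then 1 else 0 := by
  rw [AltPath.countMM, Finset.card_filter]
  change (∑ i ∈ Finset.range (2 * k + 1),
    if StepMM I M (vert w m i) (vert w m (i + 1)) then 1 else 0) = _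
  rw [sum_range_two_mul, Finset.sum_eq_zero (s := Finset.range (k + 1)), add_zero]
  · refine Finset.sum_congr rfl fun i hi => ?_
    rw [vert_odd, vert_odd_succ]
    simp only [StepMM, h.minusMinus_iff hM hN (Finset.mem_range.1 hi)]
  · intro i hi
    rw [vert_even, vert_odd]
    exact if_neg fun hp => hp.2.1 (h.mem_left i (by simpa [Nat.lt_succ_iff] using hi))

lemma two_mul_countPP_add_phiOn (h : IsMPath M N k w m) (hM : I.IsMatching M) (hN : I.IsMatching N)
    [Fintype A] [Fintype B] :
    2 * (h.toAltPath hM hN).countPP + phiOn I (men k m) (women k w) M N =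
      2 * (h.toAltPath hM hN).countMM + phiOn I (men k m) (women k w) N M + 2 := by
  rw [h.countPP_toAltPath, h.countMM_toAltPath, h.phiOn_left hM hN, h.phiOn_right hM hN,
    Finset.mul_sum, Finset.mul_sum, ← add_assoc, ← Finset.sum_add_distrib,
    ← Finset.sum_add_distrib]
  congr 1
  refine Finset.sum_congr rfl fun i _ => ?_
  by_cases h₁ : I.prefA (m i) (w (i + 1)) (w i) <;>
    by_cases h₂ : I.prefB (w (i + 1)) (m i) (m (i + 1)) <;> simp [h₁, h₂]

lemma mem_edges_toAltPath (h : IsMPath M N k w m) (hM : I.IsMatching M) (hN : I.IsMatching N)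
    {e : A × B} : e ∈ (h.toAltPath hM hN).edges ↔
      (∃ i < k + 1, (m i, w i) = e) ∨ ∃ i < k, (m i, w (i + 1)) = e := by
  obtain ⟨a, b⟩ := e
  rw [AltPath.edges, Finset.mem_filter]
  simp only [toAltPath, Prod.mk.injEq]
  constructor
  · rintro ⟨-, i, hi, hv⟩
    rcases Nat.even_or_odd' i with ⟨i, rfl | rfl⟩
    · rw [vert_even, vert_odd] at hv
      simp only [reduceCtorEq, false_and, false_or, Sum.inl.injEq, Sum.inr.injEq] at hv
      exact Or.inl ⟨i, by omega, hv.2, hv.1⟩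
    · rw [vert_odd, vert_odd_succ] at hv
      simp only [reduceCtorEq, false_and, or_false, Sum.inl.injEq, Sum.inr.injEq] at hv
      exact Or.inr ⟨i, by omega, hv⟩
  · rintro (⟨i, hi, rfl, rfl⟩ | ⟨i, hi, rfl, rfl⟩)
    · refine ⟨hM.1 (h.mem_left i (by omega)), 2 * i, by omega, Or.inr ?_⟩
      exact ⟨vert_even i, vert_odd i⟩
    · refine ⟨hN.1 (h.mem_right i hi), 2 * i + 1, by omega, Or.inl ?_⟩
      exact ⟨vert_odd i, vert_odd_succ i⟩

lemma edges_sdiff (h : IsMPath M N k w m) (hM : I.IsMatching M) (hN : I.IsMatching N) :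
    (h.toAltPath hM hN).edges \ M = (Finset.range k).image fun i => (m i, w (i + 1)) := by
  ext e
  simp only [Finset.mem_sdiff, h.mem_edges_toAltPath, Finset.mem_image, Finset.mem_range]
  constructor
  · rintro ⟨⟨i, hi, rfl⟩ | he, heM⟩
    · exact absurd (h.mem_left i (by omega)) heM
    · exact he
  · rintro ⟨i, hi, rfl⟩
    exact ⟨Or.inr ⟨i, hi, rfl⟩, h.right_notMem hM hN hi⟩

lemma inter_edges (h : IsMPath M N k w m) (hM : I.IsMatching M) (hN : I.IsMatching N) :
    M ∩ (h.toAltPath hM hN).edges = (Finset.range (k + 1)).image fun i => (m i, w i) := by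
  ext e
  simp only [Finset.mem_inter, h.mem_edges_toAltPath, Finset.mem_image, Finset.mem_range]
  constructor
  · rintro ⟨heM, he | ⟨i, hi, rfl⟩⟩
    · exact he
    · exact absurd heM (h.right_notMem hM hN hi)
  · rintro ⟨i, hi, rfl⟩
    exact ⟨h.mem_left i (by omega), Or.inl ⟨i, hi, rfl⟩⟩

lemma card_symmDiff_edges (h : IsMPath M N k w m) (hM : I.IsMatching M)
    (hN : I.IsMatching N) :
    ((M \ (h.toAltPath hM hN).edges) ∪ ((h.toAltPath hM hN).edges \ M)).card = M.card - 1 := by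
  have h₁ := Finset.card_inter_add_card_sdiff M (h.toAltPath hM hN).edges
  rw [h.inter_edges, Finset.card_image_of_injOn, Finset.card_range] at h₁
  · rw [Finset.card_union_of_disjoint disjoint_sdiff_sdiff, h.edges_sdiff,
      Finset.card_image_of_injOn, Finset.card_range]
    · omega
    · intro i hi j hj heq
      simp only [Finset.coe_range, Set.mem_Iio] at hi hj
      exact h.man_inj hM hN hi.le hj.le (Prod.mk.inj heq).1
  · intro i hi j hj heq
    simp only [Finset.coe_range, Set.mem_Iio] at hi hj
    exact h.man_inj hM hN (by omega) (by omega) (Prod.mk.inj heq).1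

lemma symmDiff_edges_eq_switch (h : IsMPath M N k w m) (hM : I.IsMatching M)
    (hN : I.IsMatching N) :
    (M \ (h.toAltPath hM hN).edges) ∪ ((h.toAltPath hM hN).edges \ M) =
      switch M N (women k w) := by
  rw [h.edges_sdiff]
  ext ⟨a, b⟩
  rw [mem_switch, Finset.mem_union, Finset.mem_sdiff, h.mem_edges_toAltPath]
  simp only [Finset.mem_image, Finset.mem_range]
  refine or_congr (and_congr_right fun hab => not_congr ?_) ?_
  · constructor
    · rintro (⟨i, hi, heq⟩ | ⟨i, hi, heq⟩)
      · exact ⟨i, by omega, (Prod.mk.inj heq).2⟩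
      · exact ⟨i + 1, hi, (Prod.mk.inj heq).2⟩
    · rintro ⟨i, hi, rfl⟩
      exact Or.inl ⟨i, by omega, by rw [hM.2.2 hab (h.mem_left i hi)]⟩
  · constructor
    · rintro ⟨i, hi, heq⟩
      obtain ⟨rfl, rfl⟩ := Prod.mk.inj heq
      exact ⟨h.mem_right i hi, i + 1, hi, rfl⟩
    · rintro ⟨hab, i, hi, rfl⟩
      cases i with
      | zero => exact absurd ⟨a, hab⟩ h.start
      | succ i => exact ⟨i, hi, by rw [hN.2.2 hab (h.mem_right i hi)]⟩

end IsMPath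

end CritInstance

/-- If `M` is a popular feasible matching and there exists a popular
feasible matching of strictly smaller cardinality, then `G` contains an `M`-alternating
path `ρ` both of whose terminal edges lie in `M`, whose endpoint in `A` is a non-critical
man, and with exactly one more `(+1,+1)` edge than `(−1,−1)` edges; consequently `M △ ρ`
is a feasible matching of cardinality `|M| − 1`. -/
theorem exists_size_reducing_path {A : Type u} {B : Type v} [Fintype A] [Fintype B]
    (I : CritInstance A B) (M : Finset (A × B)) (hM : I.IsPFM M)
    (hsmaller : ∃ N, I.IsPFM N ∧ N.card < M.card) :
    ∃ ρ : CritInstance.AltPath I M,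
      CritInstance.StepM M (ρ.vert 0) (ρ.vert 1) ∧
      CritInstance.StepM M (ρ.vert (ρ.len - 1)) (ρ.vert ρ.len) ∧
      (∃ m, (ρ.vert 0 = Sum.inl m ∨ ρ.vert ρ.len = Sum.inl m) ∧ m ∉ I.C) ∧
      ρ.countPP = ρ.countMM + 1 ∧
      I.IsFeasible ((M \ ρ.edges) ∪ (ρ.edges \ M)) ∧
      ((M \ ρ.edges) ∪ (ρ.edges \ M)).card = M.card - 1 := by
  obtain ⟨N, hN, hlt⟩ := hsmaller
  have hMm := hM.1.1
  have hNm := hN.1.1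
  obtain ⟨k, w, m, h⟩ := CritInstance.exists_isMPath_of_card_lt hMm hNm hlt
  have hcM := h.isClosedPair_left hMm
  have hcN := h.isClosedPair_right hNm
  refine ⟨h.toAltPath hMm hNm, h.mem_left 0 k.zero_le, ?_, ⟨m k, Or.inr ?_, ?_⟩, ?_, ?_,
    h.card_symmDiff_edges hMm hNm⟩
  · change CritInstance.StepM M (CritInstance.IsMPath.vert w m (2 * k))
      (CritInstance.IsMPath.vert w m (2 * k + 1))
    rw [CritInstance.IsMPath.vert_even, CritInstance.IsMPath.vert_odd]
    exact h.mem_left k le_rfl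
  · exact CritInstance.IsMPath.vert_odd k
  · exact fun hC => h.finish (hN.1.2 _ hC)
  · have h₁ := hM.phiOn_le hN.1 hcM hcN
    have h₂ := hN.phiOn_le hM.1 hcN hcM
    have h₃ := h.two_mul_countPP_add_phiOn hMm hNm
    omega
  · rw [h.symmDiff_edges_eq_switch hMm hNm]
    exact hM.1.switch hN.1 hcM hcN
end

section
/- Let G = (A ∪ B, E) be a marriage instance (a finite bipartite graph with a strict linear preference order on the neighbours of each vertex). Suppose m^0, …, m^k ∈ A are distinct men and d^1, …, d^k ∈ B are distinct women such that for every 1 ≤ j ≤ k the neighbourhood of d^j is exactly {m^{j−1}, m^j} and d^j prefers m^{j−1} to m^j; for every 1 ≤ j ≤ k, d^j is the most preferred neighbour of m^j; d^1 is the least preferred neighbour of m^0; and for every 1 ≤ j ≤ k−1, d^{j+1} is the least preferred neighbour of m^j. Then in every stable matching M of G: every d^j (1 ≤ j ≤ k) is matched; if some m^i (0 ≤ i ≤ k) is matched in M to a woman not in {d^1, …, d^k}, then M matches m^j to d^j for every j > i and matches m^j to d^{j+1} for every j < i; in particular, at most one of m^0, …, m^k is matched in M to a woman outside {d^1, …,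 d^k}. -/
open Classical

universe u v

namespace CritInstance

/-- In a stable matching, a woman who is the most preferred neighbour of some man is matched. -/
theorem IsStable.womanMatched_of_top {A : Type u} {B : Type v} {I : CritInstance A B}
    {M : Finset (A × B)} (hM : I.IsStable M) {m : A} {w : B} (hE : (m, w) ∈ I.E)
    (htop : ∀ w', (m, w') ∈ I.E → w' ≠ w → I.prefA m w w') : WomanMatched M w := by
  by_contra hw
  refine hM.2 m w ⟨hE, fun h => hw ⟨m, h⟩, ?_, Or.inl hw⟩
  by_cases hm : ManMatched M m
  · obtain ⟨w', hw'⟩ := hm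
    exact Or.inr ⟨w', hw', htop w' (hM.1.1 hw') fun h => hw ⟨m, h ▸ hw'⟩⟩
  · exact Or.inl hm

end CritInstance

/-- If consecutive men are joined by women with a partner among their two neighbours, then a man
not matched to the next woman forces all later men to be matched to their own woman. -/
theorem chain_forward {A : Type u} {B : Type v} {k : ℕ} {mm : ℕ → A} {dd : ℕ → B}
    {M : Finset (A × B)}
    (hdd_inj : ∀ i j, 1 ≤ i → i ≤ k → 1 ≤ j → j ≤ k → dd i = dd j → i = j)
    (huniq : ∀ ⦃m w w'⦄, (m, w) ∈ M → (m, w') ∈ M → w = w')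
    (hstep : ∀ j, j + 1 ≤ k → (mm j, dd (j + 1)) ∈ M ∨ (mm (j + 1), dd (j + 1)) ∈ M)
    {i : ℕ} (hi : i + 1 ≤ k → (mm i, dd (i + 1)) ∉ M) :
    ∀ j, i < j → j ≤ k → (mm j, dd j) ∈ M := by
  intro j hij
  induction j, hij using Nat.le_induction with
  | base => exact fun hk => (hstep i hk).resolve_left (hi hk)
  | succ n hn ih =>
    refine fun hk => (hstep n hk).resolve_left fun h => ?_
    have := hdd_inj _ _ (by omega) (by omega) (by omega) hk (huniq (ih (by omega)) h)
    omega

/-- If consecutive men are joined by women with a partner among their two neighbours, then a man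
not matched to his own woman forces all earlier men to be matched to the next woman. -/
theorem chain_backward {A : Type u} {B : Type v} {k : ℕ} {mm : ℕ → A} {dd : ℕ → B}
    {M : Finset (A × B)}
    (hdd_inj : ∀ i j, 1 ≤ i → i ≤ k → 1 ≤ j → j ≤ k → dd i = dd j → i = j)
    (huniq : ∀ ⦃m w w'⦄, (m, w) ∈ M → (m, w') ∈ M → w = w')
    (hstep : ∀ j, j + 1 ≤ k → (mm j, dd (j + 1)) ∈ M ∨ (mm (j + 1), dd (j + 1)) ∈ M)
    {i : ℕ} (hik : i ≤ k) (hi : 1 ≤ i → (mm i, dd i) ∉ M) :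
    ∀ j, j < i → (mm j, dd (j + 1)) ∈ M := by
  induction i with
  | zero => intro j hj; omega
  | succ n ih =>
    have hn := (hstep n hik).resolve_right (hi (by omega))
    intro j hj
    rcases Nat.lt_succ_iff_lt_or_eq.mp hj with hj | rfl
    · refine ih (by omega) (fun h1 h => ?_) j hj
      have := hdd_inj _ _ h1 (by omega) (by omega) hik (huniq h hn)
      omega
    · exact hn

/-- Suppose `m⁰, …, mᵏ` are distinct men and `d¹, …, dᵏ` are distinct
women such that the neighbourhood of each `dʲ` (`1 ≤ j ≤ k`) is exactly `{mʲ⁻¹, mʲ}` and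
`dʲ` prefers `mʲ⁻¹` to `mʲ`; `dʲ` is the most preferred neighbour of `mʲ` (`1 ≤ j ≤ k`);
`d¹` is the least preferred neighbour of `m⁰`; and `dʲ⁺¹` is the least preferred neighbour
of `mʲ` (`1 ≤ j ≤ k − 1`). Then in every stable matching `M`: every `dʲ` is matched; if
some `mⁱ` is matched to a woman outside `{d¹, …, dᵏ}`, then `mʲ` is matched to `dʲ` for
every `j > i` and to `dʲ⁺¹` for every `j < i`; in particular at most one of the `mⁱ` is
matched outside `{d¹, …, dᵏ}`. -/
theorem dummy_women_chain {A : Type u} {B : Type v}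
    (I : CritInstance A B) (k : ℕ) (mm : ℕ → A) (dd : ℕ → B)
    (hmm_inj : ∀ i j, i ≤ k → j ≤ k → mm i = mm j → i = j)
    (hdd_inj : ∀ i j, 1 ≤ i → i ≤ k → 1 ≤ j → j ≤ k → dd i = dd j → i = j)
    (hnbhd : ∀ j, 1 ≤ j → j ≤ k → ∀ a, ((a, dd j) ∈ I.E ↔ (a = mm (j - 1) ∨ a = mm j)))
    (hpref_dd : ∀ j, 1 ≤ j → j ≤ k → I.prefB (dd j) (mm (j - 1)) (mm j))
    (htop : ∀ j, 1 ≤ j → j ≤ k →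
      ∀ w, (mm j, w) ∈ I.E → w ≠ dd j → I.prefA (mm j) (dd j) w)
    (hbot0 : 1 ≤ k → ∀ w, (mm 0, w) ∈ I.E → w ≠ dd 1 → I.prefA (mm 0) w (dd 1))
    (hbot : ∀ j, 1 ≤ j → j ≤ k - 1 →
      ∀ w, (mm j, w) ∈ I.E → w ≠ dd (j + 1) → I.prefA (mm j) w (dd (j + 1)))
    (M : Finset (A × B)) (hM : I.IsStable M) :
    (∀ j, 1 ≤ j → j ≤ k → ∃ a, (a, dd j) ∈ M) ∧
    (∀ i, i ≤ k → ∀ w, (mm i, w) ∈ M → (∀ j, 1 ≤ j → j ≤ k → w ≠ dd j) →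
      (∀ j, i < j → j ≤ k → (mm j, dd j) ∈ M) ∧
      (∀ j, j < i → (mm j, dd (j + 1)) ∈ M)) ∧
    (∀ i i', i ≤ k → i' ≤ k →
      (∃ w, (mm i, w) ∈ M ∧ ∀ j, 1 ≤ j → j ≤ k → w ≠ dd j) →
      (∃ w, (mm i', w) ∈ M ∧ ∀ j, 1 ≤ j → j ≤ k → w ≠ dd j) → i = i') := by
  have hmatched : ∀ j, 1 ≤ j → j ≤ k → ∃ a, (a, dd j) ∈ M := fun j h1 hk =>
    hM.womanMatched_of_top ((hnbhd j h1 hk _).2 (Or.inr rfl)) (htop j h1 hk)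
  have hstep : ∀ j, j + 1 ≤ k → (mm j, dd (j + 1)) ∈ M ∨ (mm (j + 1), dd (j + 1)) ∈ M := by
    intro j hk
    obtain ⟨a, ha⟩ := hmatched (j + 1) (by omega) hk
    rcases (hnbhd (j + 1) (by omega) hk a).1 (hM.1.1 ha) with rfl | rfl
    · exact Or.inl ha
    · exact Or.inr ha
  have huniq := hM.1.2.1
  have hforward : ∀ i w, (mm i, w) ∈ M → (∀ j, 1 ≤ j → j ≤ k → w ≠ dd j) →
      ∀ j, i < j → j ≤ k → (mm j, dd j) ∈ M := fun i w hw hout =>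
    chain_forward hdd_inj huniq hstep fun hk h => hout _ (by omega) hk (huniq hw h)
  refine ⟨hmatched, fun i hik w hw hout => ⟨hforward i w hw hout,
    chain_backward hdd_inj huniq hstep hik fun h1 h => hout i h1 hik (huniq hw h)⟩, ?_⟩
  rintro i i' hi hi' ⟨w, hw, hout⟩ ⟨w', hw', hout'⟩
  rcases lt_trichotomy i i' with h | h | h
  · exact absurd (huniq hw' (hforward i w hw hout i' h hi')) (hout' i' (by omega) hi')
  · exact h
  · exact absurd (huniq hw (hforward i' w' hw' hout' i h hi)) (hout i (by omega) hi)
end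

section
/- Let M be a popular feasible matching in a marriage instance with critical men, and let ρ be an M-alternating path both of whose endpoints are unmatched in M (so both terminal edges of ρ lie outside M). Then the number of (+1,+1) edges of ρ is at most the number of (−1,−1) edges of ρ. -/
open Classical

universe u v

namespace CritInstance

variable {A : Type u} {B : Type v} {I : CritInstance A B} {M N : Finset (A × B)}

/-- `VPref I u v v'`: the vertex `u` strictly prefers `v` to `v'`. -/
def VPref (I : CritInstance A B) : A ⊕ B → A ⊕ B → A ⊕ B → Prop
  | Sum.inl m, Sum.inr w, Sum.inr w' => I.prefA m w w'
  | Sum.inr w, Sum.inl m, Sum.inl m' => I.prefB w m m'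
  | _, _, _ => False

/-- The vertex `u` prefers `M` to `N`. -/
def VPrefers (I : CritInstance A B) (M N : Finset (A × B)) : A ⊕ B → Prop
  | Sum.inl m => ManPrefers I M N m
  | Sum.inr w => WomanPrefers I M N w

/-- The label at `u` of the pair `(u, v)` with respect to `M` is `+1`. -/
def LabelPlus (I : CritInstance A B) (M : Finset (A × B)) (u v : A ⊕ B) : Prop :=
  ¬ VMatched M u ∨ ∃ v', StepM M u v' ∧ VPref I u v v'

theorem StepM.symm {u v : A ⊕ B} (h : StepM M u v) : StepM M v u := by
  rcases u with m | w <;> rcases v with m' | w' <;> exact h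

theorem Adj.symm {u v : A ⊕ B} (h : Adj I u v) : Adj I v u := by
  rcases u with m | w <;> rcases v with m' | w' <;> exact h

theorem vMatched_iff {u : A ⊕ B} : VMatched M u ↔ ∃ v, StepM M u v := by
  rcases u with m | w <;> simp [VMatched, ManMatched, WomanMatched, StepM]

theorem IsMatching.stepM_unique (hM : IsMatching I M) {u v v' : A ⊕ B}
    (h : StepM M u v) (h' : StepM M u v') : v = v' := by
  rcases u with m | w <;> rcases v with a | b <;> rcases v' with a' | b' <;>
    simp only [StepM] at h h'
  · rw [hM.2.1 h h']
  · rw [hM.2.2 h h']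

theorem isMatching_of_stepM_unique (hN : N ⊆ I.E)
    (h : ∀ u v v' : A ⊕ B, StepM N u v → StepM N u v' → v = v') : IsMatching I N :=
  ⟨hN, fun m w w' h₁ h₂ => Sum.inr.inj (h (Sum.inl m) (Sum.inr w) (Sum.inr w') h₁ h₂),
    fun m m' w h₁ h₂ => Sum.inl.inj (h (Sum.inr w) (Sum.inl m) (Sum.inl m') h₁ h₂)⟩

theorem IsMatching.adj_of_stepM (hM : IsMatching I M) {u v : A ⊕ B} (h : StepM M u v) :
    Adj I u v := by
  rcases u with m | w <;> rcases v with a | b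
  exacts [h, hM.1 h, hM.1 h, h]

theorem vPref_irrefl (u v : A ⊕ B) : ¬ VPref I u v v := by
  rcases u with m | w <;> rcases v with a | b <;>
    simp [VPref, I.prefA_irrefl, I.prefB_irrefl]

theorem VPref.asymm {u v v' : A ⊕ B} (h : VPref I u v v') : ¬ VPref I u v' v := by
  intro h'
  rcases u with m | w <;> rcases v with a | b <;> rcases v' with a' | b' <;>
    simp only [VPref] at h h'
  · exact I.prefA_irrefl _ _ (I.prefA_trans _ _ _ _ h h')
  · exact I.prefB_irrefl _ _ (I.prefB_trans _ _ _ _ h h')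

theorem vPref_total {u v v' : A ⊕ B} (h : Adj I u v) (h' : Adj I u v') (hne : v ≠ v') :
    VPref I u v v' ∨ VPref I u v' v := by
  rcases u with m | w <;> rcases v with a | b <;> rcases v' with a' | b' <;>
    simp only [Adj] at h h'
  · exact I.prefA_total _ _ _ h h' (fun e => hne (e ▸ rfl))
  · exact I.prefB_total _ _ _ h h' (fun e => hne (e ▸ rfl))

theorem vPrefers_iff {u : A ⊕ B} : VPrefers I M N u ↔
    ∃ v, StepM M u v ∧ (¬ VMatched N u ∨ ∃ v', StepM N u v' ∧ VPref I u v v') := by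
  rcases u with m | w <;>
    simp [VPrefers, ManPrefers, WomanPrefers, VMatched, StepM, VPref]

theorem stepPP_iff {u v : A ⊕ B} : StepPP I M u v ↔
    Adj I u v ∧ ¬ StepM M u v ∧ LabelPlus I M u v ∧ LabelPlus I M v u := by
  rcases u with m | w <;> rcases v with a | b <;>
    simp [StepPP, PlusPlus, Adj, StepM, LabelPlus, VMatched, VPref]
  tauto

theorem stepMM_iff {u v : A ⊕ B} : StepMM I M u v ↔ Adj I u v ∧ ¬ StepM M u v ∧
    (∃ v', StepM M u v' ∧ VPref I u v' v) ∧ (∃ u', StepM M v u' ∧ VPref I v u' u) := by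
  rcases u with m | w <;> rcases v with a | b <;>
    simp [StepMM, MinusMinus, Adj, StepM, VPref]
  tauto

theorem IsMatching.not_labelPlus_iff (hM : IsMatching I M) {u v : A ⊕ B} (h : Adj I u v)
    (hv : ¬ StepM M u v) :
    ¬ LabelPlus I M u v ↔ ∃ v', StepM M u v' ∧ VPref I u v' v := by
  constructor
  · intro hl
    obtain ⟨hm, hp⟩ := not_or.1 hl
    obtain ⟨v', hv'⟩ := vMatched_iff.1 (not_not.1 hm)
    refine ⟨v', hv', ?_⟩
    have hne : v ≠ v' := by rintro rfl; exact hv hv'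
    exact (vPref_total h (hM.adj_of_stepM hv') hne).resolve_left fun hp' => hp ⟨v', hv', hp'⟩
  · rintro ⟨v', hv', hp⟩ (hm | ⟨x, hx, hp'⟩)
    · exact hm (vMatched_iff.2 ⟨v', hv'⟩)
    · rw [hM.stepM_unique hx hv'] at hp'
      exact hp.asymm hp'

/-- The vote of `u` between `N` and `M`: `1` if `u` prefers `N`, `-1` if `u` prefers `M`. -/
noncomputable def vote (I : CritInstance A B) (N M : Finset (A × B)) (u : A ⊕ B) : ℤ :=
  (if VPrefers I N M u then 1 else 0) - (if VPrefers I M N u then 1 else 0)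

theorem phi_sub_phi [Fintype A] [Fintype B] :
    (phi I N M : ℤ) - phi I M N = ∑ u, vote I N M u := by
  simp only [phi, vote, Finset.sum_sub_distrib, Fintype.sum_sum_type, Nat.cast_add,
    Finset.natCast_card_filter]
  rfl

theorem vote_eq_zero (hM : IsMatching I M) (hN : IsMatching I N) {u : A ⊕ B}
    (h : ∀ v, StepM N u v ↔ StepM M u v) : vote I N M u = 0 := by
  have key : ∀ {M N : Finset (A × B)}, IsMatching I M →
      (∀ v, StepM N u v ↔ StepM M u v) → ¬ VPrefers I M N u := by
    intro M N hM h hp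
    obtain ⟨v, hv, hm | ⟨v', hv', hp⟩⟩ := vPrefers_iff.1 hp
    · exact hm (vMatched_iff.2 ⟨v, (h v).2 hv⟩)
    · rw [hM.stepM_unique hv ((h v').1 hv')] at hp
      exact vPref_irrefl _ _ hp
  simp [vote, key hM h, key hN fun v => (h v).symm]

theorem vote_eq (hM : IsMatching I M) (hN : IsMatching I N) {u v : A ⊕ B}
    (hv : StepM N u v) (hv' : ¬ StepM M u v) :
    vote I N M u = if LabelPlus I M u v then 1 else -1 := by
  have hNM : VPrefers I N M u ↔ LabelPlus I M u v := by
    rw [vPrefers_iff]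
    constructor
    · rintro ⟨x, hx, h⟩
      rwa [hN.stepM_unique hx hv] at h
    · exact fun h => ⟨v, hv, h⟩
  have hMN : VPrefers I M N u ↔ ¬ LabelPlus I M u v := by
    rw [vPrefers_iff, hM.not_labelPlus_iff (hN.adj_of_stepM hv) hv']
    constructor
    · rintro ⟨x, hx, hm | ⟨y, hy, h⟩⟩
      · exact absurd (vMatched_iff.2 ⟨v, hv⟩) hm
      · rw [hN.stepM_unique hy hv] at h
        exact ⟨x, hx, h⟩
    · rintro ⟨x, hx, h⟩
      exact ⟨x, hx, Or.inr ⟨v, hv, h⟩⟩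
  by_cases h : LabelPlus I M u v <;> simp [vote, hNM, hMN, h]

/-- The two votes along an edge of `N ∖ M` add up to twice its contribution to the difference
of the numbers of `(+1,+1)` and `(−1,−1)` edges. -/
theorem vote_add_vote (hM : IsMatching I M) (hN : IsMatching I N) {u v : A ⊕ B}
    (hv : StepM N u v) (hv' : ¬ StepM M u v) :
    vote I N M u + vote I N M v =
      2 * ((if StepPP I M u v then 1 else 0) - (if StepMM I M u v then 1 else 0)) := by
  have ha := hN.adj_of_stepM hv
  have hvu : ¬ StepM M v u := fun h => hv' h.symm
  rw [vote_eq hM hN hv hv', vote_eq hM hN hv.symm hvu]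
  simp only [stepPP_iff, stepMM_iff, ← hM.not_labelPlus_iff ha hv',
    ← hM.not_labelPlus_iff ha.symm hvu]
  by_cases h₁ : LabelPlus I M u v <;> by_cases h₂ : LabelPlus I M v u <;>
    simp [h₁, h₂, ha, hv']

namespace AltPath

/-- The partner relation of the matching obtained by switching `M` along a path whose edges
outside `M` are those at even positions. -/
def SwitchRel (ρ : AltPath I M) (u v : A ⊕ B) : Prop :=
  (StepM M u v ∧ ¬ ρ.Mem u ∧ ¬ ρ.Mem v) ∨
    ∃ k, Even k ∧ k < ρ.len ∧
      ((ρ.vert k = u ∧ ρ.vert (k + 1) = v) ∨ (ρ.vert k = v ∧ ρ.vert (k + 1) = u))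

theorem SwitchRel.symm {ρ : AltPath I M} {u v : A ⊕ B} (h : ρ.SwitchRel u v) :
    ρ.SwitchRel v u := by
  rcases h with ⟨h, hu, hv⟩ | ⟨k, hk, hl, h⟩
  · exact Or.inl ⟨h.symm, hv, hu⟩
  · exact Or.inr ⟨k, hk, hl, h.symm⟩

/-- The edge set obtained by switching `M` along the path. -/
noncomputable def switch (ρ : AltPath I M) : Finset (A × B) :=
  I.E.filter fun e => ρ.SwitchRel (Sum.inl e.1) (Sum.inr e.2)

theorem stepM_switch {ρ : AltPath I M} {u v : A ⊕ B} :
    StepM ρ.switch u v ↔ Adj I u v ∧ ρ.SwitchRel u v := by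
  rcases u with m | w <;> rcases v with a | b <;> simp only [StepM, Adj, switch, false_and,
    Finset.mem_filter]
  exact and_congr_right fun _ => ⟨SwitchRel.symm, SwitchRel.symm⟩

theorem switchRel_unique (hM : IsMatching I M) {ρ : AltPath I M} {u v v' : A ⊕ B}
    (h : ρ.SwitchRel u v) (h' : ρ.SwitchRel u v') : v = v' := by
  have mem : ∀ {k x y}, k < ρ.len →
      ((ρ.vert k = x ∧ ρ.vert (k + 1) = y) ∨ (ρ.vert k = y ∧ ρ.vert (k + 1) = x)) →
      ρ.Mem x := by
    rintro k x y hk (⟨h, -⟩ | ⟨-, h⟩)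
    exacts [⟨k, hk.le, h⟩, ⟨k + 1, hk, h⟩]
  rcases h with ⟨h, hu, -⟩ | ⟨k, hk, hl, h⟩ <;>
    rcases h' with ⟨h', hu', -⟩ | ⟨j, hj, hl', h'⟩
  · exact hM.stepM_unique h h'
  · exact absurd (mem hl' h') hu
  · exact absurd (mem hl h) hu'
  · rcases h with ⟨h₁, h₂⟩ | ⟨h₁, h₂⟩ <;> rcases h' with ⟨h₃, h₄⟩ | ⟨h₃, h₄⟩
    · obtain rfl := ρ.inj k j hl.le hl'.le (h₁.trans h₃.symm)
      exact h₂.symm.trans h₄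
    · have := ρ.inj k (j + 1) hl.le hl' (h₁.trans h₄.symm)
      grind
    · have := ρ.inj (k + 1) j hl hl'.le (h₂.trans h₃.symm)
      grind
    · obtain rfl : k = j := by simpa using ρ.inj (k + 1) (j + 1) hl hl' (h₂.trans h₄.symm)
      exact h₁.symm.trans h₃

theorem isMatching_switch (hM : IsMatching I M) (ρ : AltPath I M) : IsMatching I ρ.switch :=
  isMatching_of_stepM_unique (Finset.filter_subset _ _) fun _ _ _ h h' =>
    switchRel_unique hM (stepM_switch.1 h).2 (stepM_switch.1 h').2

theorem stepM_iff_odd {ρ : AltPath I M} (h0 : ¬ VMatched M (ρ.vert 0)) {i : ℕ}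
    (hi : i < ρ.len) : StepM M (ρ.vert i) (ρ.vert (i + 1)) ↔ Odd i := by
  induction i with
  | zero => simpa using fun h => h0 (vMatched_iff.2 ⟨_, h⟩)
  | succ i ih =>
    rw [Nat.odd_add_one, ← ih (by omega), ρ.alternate i hi, not_not]

theorem odd_len {ρ : AltPath I M} (h0 : ¬ VMatched M (ρ.vert 0))
    (h1 : ¬ VMatched M (ρ.vert ρ.len)) : Odd ρ.len := by
  obtain ⟨n, hn⟩ : ∃ n, ρ.len = n + 1 := ⟨ρ.len - 1, by have := ρ.len_pos; omega⟩
  rw [hn] at h1 ⊢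
  rw [Nat.odd_add_one, ← stepM_iff_odd h0 (by omega)]
  exact fun h => h1 (vMatched_iff.2 ⟨_, h.symm⟩)

theorem mem_of_stepM (hM : IsMatching I M) {ρ : AltPath I M} (h0 : ¬ VMatched M (ρ.vert 0))
    (h1 : ¬ VMatched M (ρ.vert ρ.len)) {u v : A ⊕ B} (hu : ρ.Mem u) (h : StepM M u v) :
    ρ.Mem v := by
  obtain ⟨i, hi, rfl⟩ := hu
  rcases Nat.even_or_odd i with he | ho
  · rcases i with _ | i
    · exact absurd (vMatched_iff.2 ⟨v, h⟩) h0
    · have hs := ((stepM_iff_odd h0 (i := i) hi).2 (by grind)).symm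
      exact ⟨i, by omega, hM.stepM_unique hs h⟩
  · rcases hi.eq_or_lt with rfl | hl
    · exact absurd (vMatched_iff.2 ⟨v, h⟩) h1
    · exact ⟨i + 1, hl, hM.stepM_unique ((stepM_iff_odd h0 hl).2 ho) h⟩

theorem stepM_switch_even (ρ : AltPath I M) {i : ℕ} (hi : i < ρ.len) (he : Even i) :
    StepM ρ.switch (ρ.vert i) (ρ.vert (i + 1)) :=
  stepM_switch.2 ⟨ρ.adj i hi, Or.inr ⟨i, he, hi, Or.inl ⟨rfl, rfl⟩⟩⟩

theorem vMatched_switch_of_mem {ρ : AltPath I M} (hl : Odd ρ.len) {u : A ⊕ B}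
    (hu : ρ.Mem u) : VMatched ρ.switch u := by
  obtain ⟨i, hi, rfl⟩ := hu
  rw [vMatched_iff]
  rcases Nat.even_or_odd i with he | ho
  · exact ⟨_, ρ.stepM_switch_even (by grind) he⟩
  · obtain ⟨j, rfl⟩ := ho
    exact ⟨_, (ρ.stepM_switch_even (i := 2 * j) hi (by simp)).symm⟩

theorem stepM_switch_of_not_mem (hM : IsMatching I M) {ρ : AltPath I M}
    (h0 : ¬ VMatched M (ρ.vert 0)) (h1 : ¬ VMatched M (ρ.vert ρ.len)) {u : A ⊕ B}
    (hu : ¬ ρ.Mem u) (v : A ⊕ B) : StepM ρ.switch u v ↔ StepM M u v := by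
  rw [stepM_switch]
  constructor
  · rintro ⟨-, ⟨h, -⟩ | ⟨k, -, hk, ⟨h, -⟩ | ⟨-, h⟩⟩⟩
    exacts [h, absurd ⟨k, hk.le, h⟩ hu, absurd ⟨k + 1, hk, h⟩ hu]
  · exact fun h => ⟨hM.adj_of_stepM h,
      Or.inl ⟨h, hu, fun hv => hu (mem_of_stepM hM h0 h1 hv h.symm)⟩⟩

theorem isFeasible_switch (hM : IsFeasible I M) {ρ : AltPath I M}
    (h0 : ¬ VMatched M (ρ.vert 0)) (h1 : ¬ VMatched M (ρ.vert ρ.len)) :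
    IsFeasible I ρ.switch := by
  refine ⟨isMatching_switch hM.1 ρ, fun m hm => ?_⟩
  change VMatched ρ.switch (Sum.inl m)
  by_cases hu : ρ.Mem (Sum.inl m)
  · exact vMatched_switch_of_mem (odd_len h0 h1) hu
  · obtain ⟨w, hw⟩ := hM.2 m hm
    exact vMatched_iff.2 ⟨Sum.inr w, (stepM_switch_of_not_mem hM.1 h0 h1 hu _).2 hw⟩

theorem sum_vote_switch [Fintype A] [Fintype B] (hM : IsMatching I M) {ρ : AltPath I M}
    (h0 : ¬ VMatched M (ρ.vert 0)) (h1 : ¬ VMatched M (ρ.vert ρ.len)) :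
    ∑ u, vote I ρ.switch M u = 2 * ((ρ.countPP : ℤ) - ρ.countMM) := by
  have hN := isMatching_switch hM ρ
  have hpath : ∑ u, vote I ρ.switch M u =
      ∑ i ∈ Finset.range (ρ.len + 1), vote I ρ.switch M (ρ.vert i) := by
    rw [← Finset.sum_image (f := vote I ρ.switch M) (g := ρ.vert) (fun i hi j hj h =>
      ρ.inj i j (by simpa [Nat.lt_succ_iff] using hi) (by simpa [Nat.lt_succ_iff] using hj) h)]
    refine (Finset.sum_subset (Finset.subset_univ _) fun u _ hu => ?_).symm
    refine vote_eq_zero hM hN (stepM_switch_of_not_mem hM h0 h1 fun ⟨i, hi, h⟩ => hu ?_)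
    exact Finset.mem_image.2 ⟨i, by simpa [Nat.lt_succ_iff] using hi, h⟩
  let gain (i : ℕ) : ℤ := (if StepPP I M (ρ.vert i) (ρ.vert (i + 1)) then 1 else 0) -
    (if StepMM I M (ρ.vert i) (ρ.vert (i + 1)) then 1 else 0)
  have hcount : (ρ.countPP : ℤ) - ρ.countMM = ∑ i ∈ Finset.range ρ.len, gain i := by
    simp only [gain, countPP, countMM, Finset.sum_sub_distrib, Finset.sum_boole]
  obtain ⟨n, hn⟩ := odd_len h0 h1
  have hpair : ∀ k ≤ n, vote I ρ.switch M (ρ.vert (2 * k)) +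
      vote I ρ.switch M (ρ.vert (2 * k + 1)) = 2 * gain (2 * k) := fun k hk =>
    vote_add_vote hM hN (ρ.stepM_switch_even (by omega) (by simp))
      (by rw [stepM_iff_odd h0 (by omega)]; simp)
  have hodd : ∀ k < n, gain (2 * k + 1) = 0 := fun k hk => by
    have hs : StepM M (ρ.vert (2 * k + 1)) (ρ.vert (2 * k + 1 + 1)) :=
      (stepM_iff_odd h0 (by omega)).2 (by simp)
    simp [gain, stepPP_iff, stepMM_iff, hs]
  have hsum : ∀ k ≤ n, ∑ i ∈ Finset.range (2 * k + 1 + 1), vote I ρ.switch M (ρ.vert i) =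
      2 * ∑ i ∈ Finset.range (2 * k + 1), gain i := by
    intro k hk
    induction k with
    | zero => simpa [Finset.sum_range_succ] using hpair 0 hk
    | succ k ih =>
      have hp := hpair (k + 1) hk
      rw [show 2 * (k + 1) = 2 * k + 1 + 1 by ring] at hp ⊢
      rw [Finset.sum_range_succ, Finset.sum_range_succ, ih (by omega), add_assoc, hp,
        Finset.sum_range_succ _ (2 * k + 1 + 1), Finset.sum_range_succ _ (2 * k + 1),
        hodd k (by omega)]
      ring
  rw [hpath, hcount, hn]
  exact hsum n le_rfl

end AltPath

end CritInstance

/-- If `M` is a popular feasible matching, then every `M`-alternating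
path both of whose endpoints are unmatched in `M` has at most as many `(+1,+1)` edges as
`(−1,−1)` edges. -/
theorem altPath_unmatched_ends_countPP_le {A : Type u} {B : Type v} [Fintype A] [Fintype B]
    (I : CritInstance A B) (M : Finset (A × B)) (hM : I.IsPFM M)
    (ρ : CritInstance.AltPath I M)
    (h0 : ¬ CritInstance.VMatched M (ρ.vert 0))
    (h1 : ¬ CritInstance.VMatched M (ρ.vert ρ.len)) :
    ρ.countPP ≤ ρ.countMM := by
  have h := CritInstance.phi_sub_phi (I := I) (N := ρ.switch) (M := M)
  rw [CritInstance.AltPath.sum_vote_switch hM.1.1 h0 h1] at h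
  have := hM.2 _ (CritInstance.AltPath.isFeasible_switch hM.1 h0 h1)
  omega
end
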